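/- arXiv:1510.05070 — 2 statements merged into one kernel-verified Lean document; each statement's English description precedes it below -/
import Mathlib

section
/- If G is a graph on n vertices with maximum degree Δ(G) ≤ 2, then G admits an orientation that is ⌊2n/3⌋-quasi-oriented-antimagic. -/
/-- `D` is an orientation of the simple graph `G`: a directed graph
whose underlying undirected graph is `G`. -/
def IsOrientation {V : Type*} (G : SimpleGraph V) (D : V → V → Prop) : Prop :=
  (∀ u w : V, G.Adj u w ↔ (D u w ∨ D w u)) ∧ (∀ u w : V, ¬(D u w ∧ D w u))

open Classical in
/-- The oriented vertex sum at `v`: the sum of the labels of edges oriented toward `v`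
minus the sum of the labels of edges oriented away from `v`. -/
noncomputable def orientedSum {V : Type*} [Fintype V] (G : SimpleGraph V)
    (D : V → V → Prop) (f : Sym2 V → ℕ) (v : V) : ℤ :=
  ∑ w ∈ (G.neighborSet v).toFinite.toFinset,
    if D w v then (f s(v, w) : ℤ) else -(f s(v, w) : ℤ)

/-- `G` admits an orientation that is `k`-quasi-oriented-antimagic: there is an
orientation `D` of `G` and an injective edge labeling into `{1, …, |E(G)| + k}`
such that the oriented vertex sums are pairwise distinct over all vertices of
degree at least `1`. -/
def HasQuasiOrientedAntimagicOrientation {V : Type*} [Fintype V]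
    (G : SimpleGraph V) (k : ℕ) : Prop :=
  ∃ D : V → V → Prop, IsOrientation G D ∧
    ∃ f : Sym2 V → ℕ,
      (∀ e ∈ G.edgeSet, f e ∈ Finset.Icc 1 (Nat.card G.edgeSet + k)) ∧
      (∀ e₁ ∈ G.edgeSet, ∀ e₂ ∈ G.edgeSet, e₁ ≠ e₂ → f e₁ ≠ f e₂) ∧
      (∀ u w : V, u ≠ w →
        1 ≤ Nat.card (G.neighborSet u) → 1 ≤ Nat.card (G.neighborSet w) →
        orientedSum G D f u ≠ orientedSum G D f w)

section PathCycle

open Finset Classical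

/-- The number of elements of `S` whose key is at most that of `a`. -/
def keyRank {α : Type*} (S : Finset α) (key : α → ℕ) (a : α) : ℕ :=
  (S.filter fun b => key b ≤ key a).card

lemma keyRank_lt {α : Type*} {S : Finset α} {key : α → ℕ} {a b : α} (hb : b ∈ S)
    (h : key a < key b) : keyRank S key a < keyRank S key b := by
  refine card_lt_card ⟨fun x hx => ?_, fun hsub => ?_⟩
  · simp only [mem_filter] at hx ⊢
    exact ⟨hx.1, by omega⟩
  · have := hsub (mem_filter.2 ⟨hb, le_rfl⟩)
    simp only [mem_filter] at this
    omega

lemma keyRank_le_card {α : Type*} (S : Finset α) (key : α → ℕ) (a : α) :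
    keyRank S key a ≤ S.card :=
  card_filter_le _ _

lemma one_le_keyRank {α : Type*} {S : Finset α} {key : α → ℕ} {a : α} (ha : a ∈ S) :
    1 ≤ keyRank S key a :=
  card_pos.2 ⟨a, mem_filter.2 ⟨ha, le_rfl⟩⟩

/-- The cyclic successor of `i` in `{0, …, k - 1}`. -/
def cycSucc (k i : ℕ) : ℕ := if i + 1 = k then 0 else i + 1

/-- The cyclic predecessor of `i` in `{0, …, k - 1}`. -/
def cycPred (k i : ℕ) : ℕ := if i = 0 then k - 1 else i - 1

lemma cycSucc_lt {k i : ℕ} (h : i < k) : cycSucc k i < k := by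
  unfold cycSucc; split_ifs <;> omega

lemma cycSucc_cycPred {k i : ℕ} (h : i < k) : cycSucc k (cycPred k i) = i := by
  unfold cycSucc cycPred; split_ifs <;> omega

lemma cycPred_cycSucc {k i : ℕ} (h : i < k) : cycPred k (cycSucc k i) = i := by
  grind [cycSucc, cycPred]

lemma cycPred_lt {k i : ℕ} (h : i < k) : cycPred k i < k := by
  unfold cycPred; split_ifs <;> omega

/-- The isomorphism type of a disjoint union of nontrivial paths and cycles: the component `j`
has `size j` vertices, numbered `0, …, size j - 1` along the component. -/
structure PathCycleShape where
  num : ℕ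
  size : ℕ → ℕ
  cyclic : ℕ → Prop
  two_le_size : ∀ j < num, 2 ≤ size j
  three_le_size : ∀ j < num, cyclic j → 3 ≤ size j

namespace PathCycleShape

variable (s : PathCycleShape)

/-- The `i`-th vertex of component `j` is joined to its cyclic successor. -/
def IsEdge (j i : ℕ) : Prop := j < s.num ∧ i < s.size j ∧ (i + 1 < s.size j ∨ s.cyclic j)

noncomputable def verts : Finset (Σ _ : ℕ, ℕ) :=
  (range s.num).sigma fun j => range (s.size j)

noncomputable def edges : Finset (Σ _ : ℕ, ℕ) := s.verts.filter fun p => s.IsEdge p.1 p.2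

noncomputable def core : Finset (Σ _ : ℕ, ℕ) :=
  s.verts.filter fun p => p.2 + 1 < 2 * (s.size p.1 / 2)

/-- Components are sorted as even paths, odd paths, odd cycles, even cycles. -/
noncomputable def kind (j : ℕ) : ℕ :=
  if s.cyclic j then (if s.size j % 2 = 0 then 3 else 2) else (if s.size j % 2 = 0 then 0 else 1)

noncomputable def compKey (j : ℕ) : ℕ := s.kind j * s.num + j

/-- The components that are not even paths. -/
noncomputable def special : Finset ℕ := (range s.num).filter fun j => s.kind j ≠ 0

noncomputable def compRank (j : ℕ) : ℕ := keyRank s.special s.compKey j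

/-- The distance of a core edge from the ends of the core. -/
noncomputable def level (j i : ℕ) : ℕ := min i (2 * (s.size j / 2) - 2 - i)

noncomputable def edgeKey (p : Σ _ : ℕ, ℕ) : ℕ :=
  2 * (s.level p.1 p.2 * (4 * s.num) + s.compKey p.1) + if p.2 < s.size p.1 / 2 then 0 else 1

/-- The label of the edge from vertex `i` of component `j` to its cyclic successor. -/
noncomputable def label (j i : ℕ) : ℕ :=
  if i + 1 < 2 * (s.size j / 2) then 3 * s.special.card + keyRank s.core s.edgeKey ⟨j, i⟩
  else if i + 1 = s.size j then
    if s.cyclic j then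
      if s.size j % 2 = 0 then s.special.card + 2 * s.compRank j else s.compRank j
    else 0
  else if s.cyclic j then s.special.card + 2 * s.compRank j else s.compRank j

/-- Edges are oriented towards their end of even index, and towards vertex `0` in the case of the
edge closing an odd cycle. `IsForward` says that the edge leaves vertex `i`. -/
def IsForward (j i : ℕ) : Prop := i % 2 = 1 ∨ i + 1 = s.size j

/-- The oriented vertex sum at vertex `i` of component `j`. -/
noncomputable def vsum (j i : ℕ) : ℤ :=
  (if s.IsForward j i then -(s.label j i : ℤ) else s.label j i) +
    if s.IsForward j (cycPred (s.size j) i) then (s.label j (cycPred (s.size j) i) : ℤ)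
    else -(s.label j (cycPred (s.size j) i) : ℤ)

variable {s}

lemma mem_verts {j i : ℕ} : (⟨j, i⟩ : Σ _ : ℕ, ℕ) ∈ s.verts ↔ j < s.num ∧ i < s.size j := by
  simp [verts]

lemma mem_edges {j i : ℕ} : (⟨j, i⟩ : Σ _ : ℕ, ℕ) ∈ s.edges ↔ s.IsEdge j i := by
  rw [edges, mem_filter, mem_verts]
  exact ⟨And.right, fun h => ⟨⟨h.1, h.2.1⟩, h⟩⟩

lemma mem_core {j i : ℕ} : (⟨j, i⟩ : Σ _ : ℕ, ℕ) ∈ s.core ↔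
    j < s.num ∧ i + 1 < 2 * (s.size j / 2) := by
  simp only [core, mem_filter, mem_verts]
  constructor
  · tauto
  · rintro ⟨h1, h2⟩
    exact ⟨⟨h1, by omega⟩, h2⟩

lemma mem_special {j : ℕ} : j ∈ s.special ↔ j < s.num ∧ (s.cyclic j ∨ s.size j % 2 = 1) := by
  rw [special, mem_filter, mem_range, kind]
  split_ifs <;> grind

lemma kind_le (j : ℕ) : s.kind j ≤ 3 := by
  unfold kind
  split_ifs <;> omega

lemma compKey_lt {j : ℕ} (hj : j < s.num) : s.compKey j < 4 * s.num := by
  have := s.kind_le j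
  unfold compKey
  nlinarith

lemma compKey_injective {j j' : ℕ} (hj : j < s.num) (hj' : j' < s.num)
    (h : s.compKey j = s.compKey j') : j = j' := by
  unfold compKey at h
  rcases lt_trichotomy (s.kind j) (s.kind j') with h1 | h1 | h1
  · nlinarith
  · rw [h1] at h; omega
  · nlinarith

lemma kind_le_of_compKey_lt {j j' : ℕ} (hj' : j' < s.num)
    (h : s.compKey j < s.compKey j') : s.kind j ≤ s.kind j' := by
  unfold compKey at h
  by_contra! h1
  nlinarith

lemma compRank_lt {j j' : ℕ} (hj' : j' ∈ s.special) (h : s.compKey j < s.compKey j') :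
    s.compRank j < s.compRank j' :=
  keyRank_lt hj' h

lemma compRank_le (j : ℕ) : s.compRank j ≤ s.special.card := keyRank_le_card _ _ _

lemma one_le_compRank {j : ℕ} (hj : j ∈ s.special) : 1 ≤ s.compRank j := one_le_keyRank hj

lemma compRank_injective {j j' : ℕ} (hj : j ∈ s.special) (hj' : j' ∈ s.special)
    (h : s.compRank j = s.compRank j') : j = j' := by
  refine compKey_injective (mem_special.1 hj).1 (mem_special.1 hj').1 ?_
  rcases lt_trichotomy (s.compKey j) (s.compKey j') with h1 | h1 | h1
  · have := compRank_lt hj' h1; omega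
  · exact h1
  · have := compRank_lt hj h1; omega

lemma lex_lt {m a b l l' : ℕ} (ha : a < m) (h : l < l' ∨ l = l' ∧ a < b) :
    l * m + a < l' * m + b := by
  rcases h with h | ⟨rfl, h⟩
  · nlinarith
  · omega

lemma edgeKey_lt {j i j' i' : ℕ} (hj : j < s.num)
    (h : s.level j i < s.level j' i' ∨ s.level j i = s.level j' i' ∧ s.compKey j < s.compKey j') :
    s.edgeKey ⟨j, i⟩ < s.edgeKey ⟨j', i'⟩ := by
  have := lex_lt (compKey_lt hj) h
  simp only [edgeKey]
  split_ifs <;> omega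

lemma edgeKey_injective {j i j' i' : ℕ} (h : (⟨j, i⟩ : Σ _ : ℕ, ℕ) ∈ s.core)
    (h' : (⟨j', i'⟩ : Σ _ : ℕ, ℕ) ∈ s.core)
    (he : s.edgeKey ⟨j, i⟩ = s.edgeKey ⟨j', i'⟩) : j = j' ∧ i = i' := by
  rw [mem_core] at h h'
  have hl : s.level j i = s.level j' i' := by
    rcases lt_trichotomy (s.level j i) (s.level j' i') with h1 | h1 | h1
    · have := edgeKey_lt h.1 (Or.inl h1); omega
    · exact h1
    · have := edgeKey_lt h'.1 (Or.inl h1); omega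
  have hk : s.compKey j = s.compKey j' := by
    rcases lt_trichotomy (s.compKey j) (s.compKey j') with h1 | h1 | h1
    · have := edgeKey_lt h.1 (Or.inr ⟨hl, h1⟩); omega
    · exact h1
    · have := edgeKey_lt h'.1 (Or.inr ⟨hl.symm, h1⟩); omega
  obtain rfl := compKey_injective h.1 h'.1 hk
  refine ⟨rfl, ?_⟩
  simp only [edgeKey, level] at he hl
  split_ifs at he <;> omega

lemma label_core {j i : ℕ} (h : i + 1 < 2 * (s.size j / 2)) :
    s.label j i = 3 * s.special.card + keyRank s.core s.edgeKey ⟨j, i⟩ := by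
  simp [label, h]

lemma lt_label_core {j i : ℕ} (hj : j < s.num) (h : i + 1 < 2 * (s.size j / 2)) :
    3 * s.special.card < s.label j i := by
  have := one_le_keyRank (key := s.edgeKey) (mem_core.2 ⟨hj, h⟩)
  rw [label_core h]
  omega

lemma label_core_lt {j i j' i' : ℕ} (hj : j < s.num) (h : i + 1 < 2 * (s.size j / 2))
    (hj' : j' < s.num) (h' : i' + 1 < 2 * (s.size j' / 2))
    (hl : s.level j i < s.level j' i' ∨
      s.level j i = s.level j' i' ∧ s.compKey j < s.compKey j') :
    s.label j i < s.label j' i' := by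
  have := keyRank_lt (mem_core.2 ⟨hj', h'⟩) (edgeKey_lt hj hl)
  rw [label_core h, label_core h']
  omega

lemma label_initial_le {j i : ℕ} (h : 2 * (s.size j / 2) ≤ i + 1) :
    s.label j i ≤ 3 * s.special.card := by
  have := s.compRank_le j
  unfold label
  split_ifs <;> omega

lemma label_eq_zero {j i : ℕ} (hj : j < s.num) (hi : i < s.size j) (h : ¬ s.IsEdge j i) :
    s.label j i = 0 := by
  simp only [IsEdge, hj, hi, true_and, not_or] at h
  have : i + 1 = s.size j := by omega
  simp only [label, h.2, this]
  rw [if_neg (by omega)]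
  simp

lemma label_pos {j i : ℕ} (h : s.IsEdge j i) : 1 ≤ s.label j i := by
  obtain ⟨hj, hi, he⟩ := h
  by_cases hc : i + 1 < 2 * (s.size j / 2)
  · have := lt_label_core hj hc
    omega
  · have hs : j ∈ s.special := by
      refine mem_special.2 ⟨hj, ?_⟩
      rcases he with he | he
      · right; omega
      · exact Or.inl he
    have := one_le_compRank hs
    have h3 : i + 1 = s.size j → s.cyclic j := fun h => he.resolve_left (by omega)
    unfold label
    split_ifs <;> first | omega | (exfalso; tauto)

lemma label_injective {j i j' i' : ℕ} (h : s.IsEdge j i) (h' : s.IsEdge j' i')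
    (he : s.label j i = s.label j' i') : j = j' ∧ i = i' := by
  obtain ⟨hj, hi, hi2⟩ := h
  obtain ⟨hj', hi', hi2'⟩ := h'
  by_cases hc : i + 1 < 2 * (s.size j / 2) <;> by_cases hc' : i' + 1 < 2 * (s.size j' / 2)
  · rw [label_core hc, label_core hc'] at he
    have h1 := mem_core.2 ⟨hj, hc⟩
    have h2 := mem_core.2 ⟨hj', hc'⟩
    refine edgeKey_injective h1 h2 ?_
    rcases lt_trichotomy (s.edgeKey ⟨j, i⟩) (s.edgeKey ⟨j', i'⟩) with h3 | h3 | h3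
    · have := keyRank_lt h2 h3; omega
    · exact h3
    · have := keyRank_lt h1 h3; omega
  · have := lt_label_core hj hc
    have := s.label_initial_le (j := j') (i := i') (by omega)
    omega
  · have := lt_label_core hj' hc'
    have := s.label_initial_le (j := j) (i := i) (by omega)
    omega
  · have hs : j ∈ s.special := by
      refine mem_special.2 ⟨hj, ?_⟩
      rcases hi2 with he | he
      · right; omega
      · exact Or.inl he
    have hs' : j' ∈ s.special := by
      refine mem_special.2 ⟨hj', ?_⟩
      rcases hi2' with he | he
      · right; omega
      · exact Or.inl he
    have h1 := one_le_compRank hs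
    have h1' := one_le_compRank hs'
    have h2 := s.compRank_le j
    have h2' := s.compRank_le j'
    have hjj : j = j' := by
      refine compRank_injective hs hs' ?_
      have h3 : i + 1 = s.size j → s.cyclic j := fun h => hi2.resolve_left (by omega)
      have h3' : i' + 1 = s.size j' → s.cyclic j' := fun h => hi2'.resolve_left (by omega)
      unfold label at he
      split_ifs at he <;> first | omega | (exfalso; tauto)
    subst hjj
    refine ⟨rfl, ?_⟩
    unfold label at he
    split_ifs at he <;> omega

lemma card_special_add_card_core_le : s.special.card + s.core.card ≤ s.edges.card := by
  set φ : ℕ → Σ _ : ℕ, ℕ := fun j =>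
    ⟨j, if s.cyclic j then s.size j - 1 else s.size j - 2⟩ with hφ
  have hinj : Function.Injective φ := fun a b hab => congrArg Sigma.fst hab
  rw [← card_image_of_injective s.special hinj, ← card_union_of_disjoint]
  · refine card_le_card (union_subset ?_ ?_)
    · intro p hp
      obtain ⟨j, hj, rfl⟩ := mem_image.1 hp
      rw [mem_special] at hj
      have := s.two_le_size j hj.1
      refine mem_edges.2 ⟨hj.1, ?_⟩
      split_ifs with hc
      · exact ⟨by omega, Or.inr hc⟩
      · exact ⟨by omega, Or.inl (by omega)⟩
    · rintro ⟨j, i⟩ hp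
      rw [mem_core] at hp
      exact mem_edges.2 ⟨hp.1, by omega, Or.inl (by omega)⟩
  · rw [disjoint_left]
    intro p hp hp'
    obtain ⟨j, hj, rfl⟩ := mem_image.1 hp
    rw [mem_special] at hj
    rw [mem_core] at hp'
    have := s.two_le_size j hj.1
    by_cases hc : s.cyclic j
    · simp only [hc, if_true] at hp'
      omega
    · simp only [hc, if_false] at hp'
      have := hj.2.resolve_left hc
      omega

lemma label_le {j i : ℕ} : s.label j i ≤ s.edges.card + 2 * s.special.card := by
  have h := s.card_special_add_card_core_le
  by_cases hc : i + 1 < 2 * (s.size j / 2)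
  · rw [label_core hc]
    have := keyRank_le_card s.core s.edgeKey ⟨j, i⟩
    omega
  · have := s.label_initial_le (j := j) (i := i) (by omega)
    omega

lemma three_mul_card_special_le : 3 * s.special.card ≤ s.verts.card := by
  rw [verts, card_sigma, mul_comm, ← smul_eq_mul]
  calc s.special.card • 3 ≤ ∑ j ∈ s.special, (range (s.size j)).card := by
        refine card_nsmul_le_sum _ _ _ fun j hj => ?_
        rw [mem_special] at hj
        rw [card_range]
        have := s.two_le_size j hj.1
        rcases hj.2 with h | h
        · exact s.three_le_size j hj.1 h
        · omega
    _ ≤ _ := sum_le_sum_of_subset (filter_subset _ _)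

/-- The sum of the labels at vertex `i` of component `j`. -/
noncomputable def labelSum (s : PathCycleShape) (j i : ℕ) : ℕ :=
  s.label j (cycPred (s.size j) i) + s.label j i

lemma vsum_of_even {j i : ℕ} (hi : i < 2 * (s.size j / 2)) (h : i % 2 = 0) :
    s.vsum j i = s.labelSum j i := by
  have h1 : ¬ s.IsForward j i := by unfold IsForward; omega
  have h2 : s.IsForward j (cycPred (s.size j) i) := by
    unfold IsForward cycPred; split_ifs <;> omega
  simp only [vsum, h1, h2, if_true, if_false, labelSum]
  push_cast
  ring

lemma vsum_of_odd {j i : ℕ} (hi : i < 2 * (s.size j / 2)) (h : i % 2 = 1) :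
    s.vsum j i = -s.labelSum j i := by
  have h1 : s.IsForward j i := Or.inl h
  have h2 : ¬ s.IsForward j (cycPred (s.size j) i) := by
    unfold IsForward cycPred; split_ifs <;> omega
  simp only [vsum, h1, h2, if_true, if_false, labelSum]
  push_cast
  ring

lemma vsum_last {j i : ℕ} (hj : j < s.num) (hi : i < s.size j) (h : 2 * (s.size j / 2) ≤ i) :
    s.vsum j i = if s.cyclic j then (s.special.card + s.compRank j : ℤ) else s.compRank j := by
  have h0 := s.two_le_size j hj
  have h1 : s.IsForward j i := Or.inr (by omega)
  have hp : cycPred (s.size j) i = i - 1 := by unfold cycPred; split_ifs <;> omega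
  have h2 : s.IsForward j (i - 1) := Or.inl (by omega)
  simp only [vsum, hp, h1, h2, if_true, label]
  split_ifs <;> push_cast <;> omega

/-- Among the edges at vertex `i` there is one whose level is that of the vertex; the other one
is either one level below or an initial edge. -/
lemma labelSum_eq {j i : ℕ} (hi : i < 2 * (s.size j / 2)) :
    ∃ u l, s.labelSum j i = s.label j u + s.label j l ∧ u + 1 < 2 * (s.size j / 2) ∧
      s.level j u = min i (2 * (s.size j / 2) - 1 - i) ∧
      (l + 1 < 2 * (s.size j / 2) ∧ s.level j l + 1 = min i (2 * (s.size j / 2) - 1 - i) ∨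
        min i (2 * (s.size j / 2) - 1 - i) = 0 ∧
          (i = 0 ∧ l = s.size j - 1 ∨ i % 2 = 1 ∧ l = 2 * (s.size j / 2) - 1)) := by
  by_cases h : i < s.size j / 2
  · refine ⟨i, cycPred (s.size j) i, add_comm _ _, by omega, by unfold level; omega, ?_⟩
    unfold cycPred level
    split_ifs <;> omega
  · refine ⟨cycPred (s.size j) i, i, rfl, ?_⟩
    unfold cycPred level
    split_ifs <;> omega

lemma label_initial_mono {j j' : ℕ} (hj : j < s.num) (hj' : j' < s.num)
    (h : s.compKey j < s.compKey j') :
    s.label j (s.size j - 1) ≤ s.label j' (s.size j' - 1) ∧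
      s.label j (2 * (s.size j / 2) - 1) ≤ s.label j' (2 * (s.size j' / 2) - 1) := by
  have h1 := kind_le_of_compKey_lt hj' h
  have h2 := s.two_le_size j hj
  have h2' := s.two_le_size j' hj'
  have h3 : j' ∈ s.special → s.compRank j < s.compRank j' := fun h' => compRank_lt h' h
  have h4 := s.compRank_le j
  simp only [mem_special, hj', true_and] at h3
  unfold kind at h1
  unfold label
  constructor
  · split_ifs at h1 ⊢ <;> first | omega | grind
  · split_ifs at h1 ⊢ <;> first | omega | grind

/-- Among vertices of the same sign, label sums increase with the level and then with the
component. -/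
lemma labelSum_lt {j i j' i' : ℕ} (hj : j < s.num) (hj' : j' < s.num)
    (hi : i < 2 * (s.size j / 2)) (hi' : i' < 2 * (s.size j' / 2)) (hpar : i % 2 = i' % 2)
    (h : min i (2 * (s.size j / 2) - 1 - i) < min i' (2 * (s.size j' / 2) - 1 - i') ∨
      min i (2 * (s.size j / 2) - 1 - i) = min i' (2 * (s.size j' / 2) - 1 - i') ∧
        s.compKey j < s.compKey j') :
    s.labelSum j i < s.labelSum j' i' := by
  obtain ⟨u, l, hs, hu, hul, hl⟩ := labelSum_eq hi
  obtain ⟨u', l', hs', hu', hul', hl'⟩ := labelSum_eq hi'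
  rw [hs, hs']
  refine add_lt_add_of_lt_of_le (label_core_lt hj hu hj' hu' (by rwa [hul, hul'])) ?_
  rcases hl with ⟨hl1, hl2⟩ | ⟨hl1, hl2⟩ <;> rcases hl' with ⟨hl1', hl2'⟩ | ⟨hl1', hl2'⟩
  · exact (label_core_lt hj hl1 hj' hl1' (by omega)).le
  · omega
  · have h1 := lt_label_core hj' hl1'
    have h2 := s.label_initial_le (j := j) (i := l) (by omega)
    omega
  · have h1 := label_initial_mono hj hj' (by omega)
    rcases hl2 with ⟨h2, rfl⟩ | ⟨h2, rfl⟩ <;> rcases hl2' with ⟨h2', rfl⟩ | ⟨h2', rfl⟩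
    · exact h1.1
    · omega
    · omega
    · exact h1.2

lemma lt_labelSum {j i : ℕ} (hj : j < s.num) (hi : i < 2 * (s.size j / 2)) :
    3 * s.special.card < s.labelSum j i := by
  unfold labelSum
  by_cases h : i + 1 < 2 * (s.size j / 2)
  · have := lt_label_core hj h
    omega
  · have := s.lt_label_core (i := cycPred (s.size j) i) hj (by unfold cycPred; split_ifs <;> omega)
    omega

lemma labelSum_injective {j i j' i' : ℕ} (hj : j < s.num) (hj' : j' < s.num)
    (hi : i < 2 * (s.size j / 2)) (hi' : i' < 2 * (s.size j' / 2)) (hpar : i % 2 = i' % 2)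
    (h : s.labelSum j i = s.labelSum j' i') : j = j' ∧ i = i' := by
  rcases lt_trichotomy (min i (2 * (s.size j / 2) - 1 - i))
    (min i' (2 * (s.size j' / 2) - 1 - i')) with h1 | h1 | h1
  · have := labelSum_lt hj hj' hi hi' hpar (Or.inl h1); omega
  · rcases lt_trichotomy (s.compKey j) (s.compKey j') with h2 | h2 | h2
    · have := labelSum_lt hj hj' hi hi' hpar (Or.inr ⟨h1, h2⟩); omega
    · obtain rfl := compKey_injective hj hj' h2
      exact ⟨rfl, by omega⟩
    · have := labelSum_lt hj' hj hi' hi hpar.symm (Or.inr ⟨h1.symm, h2⟩); omega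
  · have := labelSum_lt hj' hj hi' hi hpar.symm (Or.inl h1); omega

lemma vsum_last_mem {j i : ℕ} (hj : j < s.num) (hi : i < s.size j)
    (h : 2 * (s.size j / 2) ≤ i) : 1 ≤ s.vsum j i ∧ s.vsum j i ≤ 3 * s.special.card := by
  have h1 := s.one_le_compRank (mem_special.2 ⟨hj, Or.inr (by omega)⟩)
  have h2 := s.compRank_le j
  rw [vsum_last hj hi h]
  split_ifs <;> omega

lemma vsum_ne_last {j i j' i' : ℕ} (hj : j < s.num) (hj' : j' < s.num)
    (hi : i < 2 * (s.size j / 2)) (hi' : i' < s.size j') (h' : 2 * (s.size j' / 2) ≤ i') :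
    s.vsum j i ≠ s.vsum j' i' := by
  have h1 := vsum_last_mem hj' hi' h'
  have h2 := lt_labelSum hj hi
  rcases Nat.mod_two_eq_zero_or_one i with hp | hp
  · rw [vsum_of_even hi hp]; omega
  · rw [vsum_of_odd hi hp]; omega

lemma vsum_injective {j i j' i' : ℕ} (hj : j < s.num) (hi : i < s.size j) (hj' : j' < s.num)
    (hi' : i' < s.size j') (h : s.vsum j i = s.vsum j' i') : j = j' ∧ i = i' := by
  by_cases hc : i < 2 * (s.size j / 2) <;> by_cases hc' : i' < 2 * (s.size j' / 2)
  · have h1 := lt_labelSum hj hc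
    have h2 := lt_labelSum hj' hc'
    rcases Nat.mod_two_eq_zero_or_one i with hp | hp <;>
      rcases Nat.mod_two_eq_zero_or_one i' with hp' | hp'
    · rw [vsum_of_even hc hp, vsum_of_even hc' hp'] at h
      exact labelSum_injective hj hj' hc hc' (by omega) (by omega)
    · rw [vsum_of_even hc hp, vsum_of_odd hc' hp'] at h
      omega
    · rw [vsum_of_odd hc hp, vsum_of_even hc' hp'] at h
      omega
    · rw [vsum_of_odd hc hp, vsum_of_odd hc' hp'] at h
      exact labelSum_injective hj hj' hc hc' (by omega) (by omega)
  · exact absurd h (vsum_ne_last hj hj' hc hi' (by omega))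
  · exact absurd h.symm (vsum_ne_last hj' hj hc' hi (by omega))
  · have hs := mem_special.2 ⟨hj, Or.inr (show s.size j % 2 = 1 by omega)⟩
    have hs' := mem_special.2 ⟨hj', Or.inr (show s.size j' % 2 = 1 by omega)⟩
    have h1 := one_le_compRank hs
    have h1' := one_le_compRank hs'
    have h2 := s.compRank_le j
    have h2' := s.compRank_le j'
    rw [vsum_last hj hi (by omega), vsum_last hj' hi' (by omega)] at h
    have hjj : j = j' := by
      refine compRank_injective hs hs' ?_
      split_ifs at h <;> omega
    subst hjj
    exact ⟨rfl, by omega⟩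

end PathCycleShape

/-- A numbering of the vertices of a disjoint union of paths and cycles that are not isolated. -/
structure PathCycleDecomposition {V : Type*} (G : SimpleGraph V) extends PathCycleShape where
  vert : ℕ → ℕ → V
  vert_injective : ∀ {j i j' i' : ℕ}, j < num → i < size j → j' < num → i' < size j' →
    vert j i = vert j' i' → j = j' ∧ i = i'
  adj_iff : ∀ u w, G.Adj u w ↔ ∃ j i, toPathCycleShape.IsEdge j i ∧
    (u = vert j i ∧ w = vert j (cycSucc (size j) i) ∨
      w = vert j i ∧ u = vert j (cycSucc (size j) i))

/-- `n` distinct vertices `y 0, …, y (n - 1)`, consecutive ones being adjacent. -/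
def IsPathSeq {V : Type*} (G : SimpleGraph V) (y : ℕ → V) (n : ℕ) : Prop :=
  (∀ i < n, ∀ i' < n, y i = y i' → i = i') ∧ ∀ i, i + 1 < n → G.Adj (y i) (y (i + 1))

lemma IsPathSeq.le_card {V : Type*} [Fintype V] {G : SimpleGraph V} {y : ℕ → V} {n : ℕ}
    (h : IsPathSeq G y n) : n ≤ Fintype.card V := by
  simpa using Fintype.card_le_of_injective (fun i : Fin n => y i)
    fun a b hab => Fin.ext (h.1 _ a.2 _ b.2 hab)

lemma exists_maximal_isPathSeq {V : Type*} [Fintype V] {G : SimpleGraph V} {u w : V}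
    (h : G.Adj u w) :
    ∃ n y, 2 ≤ n ∧ IsPathSeq G y n ∧ ∀ y', ¬ IsPathSeq G y' (n + 1) := by
  have h2 : ∃ y, IsPathSeq G y 2 := by
    refine ⟨fun i => if i = 0 then u else w, ?_, ?_⟩
    · intro i hi i' hi'
      have := h.ne
      have := h.ne'
      interval_cases i <;> interval_cases i' <;> simp_all
    · intro i hi
      obtain rfl : i = 0 := by omega
      simpa using h
  have hb : 2 ≤ Fintype.card V := h2.elim fun y hy => hy.le_card
  obtain ⟨y, hy⟩ := Nat.findGreatest_spec (P := fun n => ∃ y, IsPathSeq G y n) hb h2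
  refine ⟨_, y, Nat.le_findGreatest hb h2, hy, fun y' hy' => ?_⟩
  have := Nat.le_findGreatest (P := fun n => ∃ y, IsPathSeq G y n) hy'.le_card ⟨y', hy'⟩
  omega

lemma IsPathSeq.snoc {V : Type*} {G : SimpleGraph V} {y : ℕ → V} {n : ℕ} {w : V}
    (h : IsPathSeq G y n) (hw : ∀ i < n, y i ≠ w) (hadj : G.Adj (y (n - 1)) w) :
    IsPathSeq G (fun i => if i < n then y i else w) (n + 1) := by
  refine ⟨fun i hi i' hi' he => ?_, fun i hi => ?_⟩
  · simp only at he
    split_ifs at he with h1 h2 h2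
    · exact h.1 i h1 i' h2 he
    · exact absurd he (hw i h1)
    · exact absurd he.symm (hw i' h2)
    · omega
  · simp only
    rw [if_pos (by omega)]
    split_ifs with h1
    · exact h.2 i h1
    · obtain rfl : i = n - 1 := by omega
      exact hadj

lemma IsPathSeq.reverse {V : Type*} {G : SimpleGraph V} {y : ℕ → V} {n : ℕ}
    (h : IsPathSeq G y n) : IsPathSeq G (fun i => y (n - 1 - i)) n := by
  refine ⟨fun i hi i' hi' he => ?_, fun i hi => ?_⟩
  · have := h.1 _ (by omega) _ (by omega) he
    omega
  · have := h.2 (n - 1 - (i + 1)) (by omega)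
    rw [show n - 1 - (i + 1) + 1 = n - 1 - i by omega] at this
    exact this.symm

lemma IsPathSeq.exists_of_adj_last {V : Type*} {G : SimpleGraph V} {y : ℕ → V} {n : ℕ}
    (hdeg : ∀ v a b w, G.Adj v a → G.Adj v b → G.Adj v w → a ≠ b → w = a ∨ w = b)
    (h : IsPathSeq G y n) (hmax : ∀ y', ¬ IsPathSeq G y' (n + 1)) {w : V}
    (hadj : G.Adj (y (n - 1)) w) :
    w = y (n - 2) ∨ w = y 0 := by
  by_contra! hne
  refine hmax _ (h.snoc (w := w) ?_ hadj)
  rintro i hi rfl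
  have hi0 : i ≠ 0 := by rintro rfl; exact hne.2 rfl
  have hin : i ≠ n - 1 := by rintro rfl; exact hadj.ne rfl
  have h1 := h.2 i (by omega)
  have h2 := h.2 (i - 1) (by omega)
  rw [show i - 1 + 1 = i by omega] at h2
  have h3 : y (i - 1) ≠ y (i + 1) := fun he => by
    have := h.1 _ (by omega) _ (by omega) he
    omega
  rcases hdeg _ _ _ _ h2.symm h1 hadj.symm h3 with h4 | h4
  · have := h.1 _ (by omega) _ (by omega) h4
    omega
  · have := h.1 _ (by omega) _ (by omega) h4
    exact hne.1 (by rw [show n - 2 = i by omega])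

/-- Neighbours of the vertices of a maximal path. -/
lemma IsPathSeq.exists_of_adj {V : Type*} {G : SimpleGraph V} {y : ℕ → V} {n : ℕ}
    (hdeg : ∀ v a b w, G.Adj v a → G.Adj v b → G.Adj v w → a ≠ b → w = a ∨ w = b)
    (h : IsPathSeq G y n) (hmax : ∀ y', ¬ IsPathSeq G y' (n + 1)) (hn : 2 ≤ n) {i : ℕ}
    (hi : i < n) {w : V} (hadj : G.Adj (y i) w) :
    ∃ i' < n, w = y i' ∧ (i + 1 = i' ∨ i' + 1 = i ∨ i = 0 ∧ i' + 1 = n ∨ i' = 0 ∧ i + 1 = n) := by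
  by_cases h0 : i = 0
  · subst h0
    have hadj' : G.Adj ((fun i => y (n - 1 - i)) (n - 1)) w := by simpa using hadj
    rcases h.reverse.exists_of_adj_last hdeg hmax hadj' with h1 | h1
    · exact ⟨_, by omega, h1, by omega⟩
    · exact ⟨_, by omega, h1, by omega⟩
  by_cases h1 : i = n - 1
  · subst h1
    rcases h.exists_of_adj_last hdeg hmax hadj with h1 | h1
    · exact ⟨_, by omega, h1, by omega⟩
    · exact ⟨_, by omega, h1, by omega⟩
  have h1 := h.2 i (by omega)
  have h2 := h.2 (i - 1) (by omega)
  rw [show i - 1 + 1 = i by omega] at h2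
  have h3 : y (i - 1) ≠ y (i + 1) := fun he => by
    have := h.1 _ (by omega) _ (by omega) he
    omega
  rcases hdeg _ _ _ _ h2.symm h1 hadj h3 with h4 | h4
  · exact ⟨_, by omega, h4, by omega⟩
  · exact ⟨_, by omega, h4, by omega⟩

namespace PathCycleDecomposition

variable {V : Type*} {G : SimpleGraph V}

lemma exists_adj (d : PathCycleDecomposition G) {j i : ℕ} (hj : j < d.num) (hi : i < d.size j) :
    ∃ w, G.Adj (d.vert j i) w := by
  have h2 := d.two_le_size j hj
  by_cases h : i + 1 < d.size j
  · exact ⟨_, (d.adj_iff _ _).2 ⟨j, i, ⟨hj, hi, Or.inl h⟩, Or.inl ⟨rfl, rfl⟩⟩⟩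
  · refine ⟨d.vert j (i - 1), (d.adj_iff _ _).2
      ⟨j, i - 1, ⟨hj, by omega, Or.inl (by omega)⟩, Or.inr ⟨rfl, ?_⟩⟩⟩
    rw [cycSucc, if_neg (by omega), show i - 1 + 1 = i by omega]

/-- The graph obtained by adding a path or cycle on isolated vertices. -/
def cons {H : SimpleGraph V} (d : PathCycleDecomposition H) (n : ℕ) (c : Prop) (y : ℕ → V)
    (hn : 2 ≤ n) (hc : c → 3 ≤ n) (hy : ∀ i < n, ∀ i' < n, y i = y i' → i = i')
    (hH : ∀ i < n, ∀ w, ¬ H.Adj (y i) w)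
    (hG : ∀ u w, G.Adj u w ↔ H.Adj u w ∨ ∃ i < n, (i + 1 < n ∨ c) ∧
      (u = y i ∧ w = y (cycSucc n i) ∨ w = y i ∧ u = y (cycSucc n i))) :
    PathCycleDecomposition G where
  num := d.num + 1
  size j := if j = d.num then n else d.size j
  cyclic j := if j = d.num then c else d.cyclic j
  vert j := if j = d.num then y else d.vert j
  two_le_size j hj := by
    have := d.two_le_size j
    split_ifs <;> grind
  three_le_size j hj := by
    have := d.three_le_size j
    split_ifs <;> grind
  vert_injective {j i j' i'} hj hi hj' hi' he := by
    split_ifs at hi hi' he with h1 h2 h2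
    · exact ⟨by omega, hy i hi i' hi' he⟩
    · obtain ⟨w, hw⟩ := d.exists_adj (j := j') (i := i') (by omega) hi'
      exact absurd (he ▸ hw) (hH i hi w)
    · obtain ⟨w, hw⟩ := d.exists_adj (j := j) (i := i) (by omega) hi
      exact absurd (he ▸ hw) (hH i' hi' w)
    · exact d.vert_injective (by omega) hi (by omega) hi' he
  adj_iff u w := by
    rw [hG, d.adj_iff]
    constructor
    · rintro (⟨j, i, ⟨h1, h2, h3⟩, h⟩ | ⟨i, h1, h2, h⟩)
      · have hj : j ≠ d.num := by omega
        refine ⟨j, i, ⟨by simp only; omega, ?_, ?_⟩, ?_⟩ <;> simpa [hj]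
      · refine ⟨d.num, i, ⟨by simp, ?_, ?_⟩, ?_⟩ <;> simpa
    · rintro ⟨j, i, ⟨h1, h2, h3⟩, h⟩
      by_cases hj : j = d.num
      · simp only [hj, if_true] at h2 h3 h
        exact Or.inr ⟨i, h2, h3, h⟩
      · simp only [hj, if_false] at h1 h2 h3 h
        exact Or.inl ⟨j, i, ⟨by omega, h2, h3⟩, h⟩

/-- A finite graph of maximum degree at most two is a disjoint union of paths and cycles. -/
theorem nonempty_of_degree_le_two [Fintype V] [Nonempty V] (G : SimpleGraph V)
    (hdeg : ∀ v a b w, G.Adj v a → G.Adj v b → G.Adj v w → a ≠ b → w = a ∨ w = b) :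
    Nonempty (PathCycleDecomposition G) := by
  induction hm : G.edgeSet.ncard using Nat.strong_induction_on generalizing G with
  | _ m ih =>
  by_cases hE : ∃ u w, G.Adj u w
  swap
  · have hV : ∀ u w, ¬ G.Adj u w := fun u w h => hE ⟨u, w, h⟩
    exact ⟨⟨⟨0, fun _ => 0, fun _ => False, by simp, by simp⟩, fun _ _ => Classical.arbitrary V,
      by simp, by simp [hV, PathCycleShape.IsEdge]⟩⟩
  obtain ⟨u₀, w₀, h₀⟩ := hE
  obtain ⟨n, y, hn, hy, hmax⟩ := exists_maximal_isPathSeq h₀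
  let H : SimpleGraph V :=
    { Adj := fun u w => G.Adj u w ∧ (∀ i < n, y i ≠ u) ∧ ∀ i < n, y i ≠ w
      symm := ⟨fun u w h => ⟨h.1.symm, h.2.2, h.2.1⟩⟩
      loopless := ⟨fun u h => h.1.ne rfl⟩ }
  have hlt : H.edgeSet.ncard < G.edgeSet.ncard := by
    refine Set.ncard_lt_ncard ⟨?_, fun hsub => ?_⟩ (Set.toFinite _)
    · exact SimpleGraph.edgeSet_mono fun u w h => h.1
    · have h1 : s(y 0, y 1) ∈ G.edgeSet := hy.2 0 (by omega)
      exact (hsub h1).2.1 0 (by omega) rfl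
  obtain ⟨d⟩ := ih _ (hm ▸ hlt) H
    (fun v a b w h1 h2 h3 => hdeg v a b w h1.1 h2.1 h3.1) rfl
  refine ⟨d.cons n (3 ≤ n ∧ G.Adj (y (n - 1)) (y 0)) y hn And.left hy.1
    (fun i hi w hw => hw.2.1 i hi rfl) fun u w => ⟨fun h => ?_, ?_⟩⟩
  · have key : ∀ a b, G.Adj a b → (∃ i < n, y i = a) → ∃ i < n,
        (i + 1 < n ∨ 3 ≤ n ∧ G.Adj (y (n - 1)) (y 0)) ∧
          (a = y i ∧ b = y (cycSucc n i) ∨ b = y i ∧ a = y (cycSucc n i)) := by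
      rintro a b hab ⟨i, hi, rfl⟩
      obtain ⟨i', hi', rfl, hii⟩ := hy.exists_of_adj hdeg hmax hn hi hab
      have hsucc : ∀ i, i + 1 < n → cycSucc n i = i + 1 := fun i h => if_neg (by omega)
      have hzero : cycSucc n (n - 1) = 0 := if_pos (by omega)
      by_cases h1 : i + 1 = i'
      · exact ⟨i, hi, Or.inl (by omega), Or.inl ⟨rfl, by rw [hsucc i (by omega), h1]⟩⟩
      by_cases h2 : i' + 1 = i
      · exact ⟨i', hi', Or.inl (by omega), Or.inr ⟨rfl, by rw [hsucc i' (by omega), h2]⟩⟩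
      rcases hii with h | h | ⟨rfl, h⟩ | ⟨rfl, h⟩
      · exact absurd h h1
      · exact absurd h h2
      · obtain rfl : i' = n - 1 := by omega
        exact ⟨n - 1, hi', Or.inr ⟨by omega, hab.symm⟩, Or.inr ⟨rfl, by rw [hzero]⟩⟩
      · obtain rfl : i = n - 1 := by omega
        exact ⟨n - 1, hi, Or.inr ⟨by omega, hab⟩, Or.inl ⟨rfl, by rw [hzero]⟩⟩
    by_cases hu : ∃ i < n, y i = u
    · exact Or.inr (key u w h hu)
    by_cases hw : ∃ i < n, y i = w
    · obtain ⟨i, hi, h1, h2⟩ := key w u h.symm hw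
      exact Or.inr ⟨i, hi, h1, h2.symm⟩
    push Not at hu hw
    exact Or.inl ⟨h, hu, hw⟩
  · rintro (h | ⟨i, hi, h1, h⟩)
    · exact h.1
    · have h2 : G.Adj (y i) (y (cycSucc n i)) := by
        unfold cycSucc
        split_ifs with h3
        · rw [show i = n - 1 by omega]
          exact (h1.resolve_left (by omega)).2
        · exact hy.2 i (by omega)
      rcases h with ⟨rfl, rfl⟩ | ⟨rfl, rfl⟩
      · exact h2
      · exact h2.symm

variable (d : PathCycleDecomposition G)

/-- The edge from vertex `i` of component `j` to its cyclic successor. -/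
def edge (p : Σ _ : ℕ, ℕ) : Sym2 V := s(d.vert p.1 p.2, d.vert p.1 (cycSucc (d.size p.1) p.2))

variable {d}

lemma eq_of_vert_eq {j i j' i' : ℕ} (h : d.IsEdge j i) (h' : d.IsEdge j' i')
    (he : d.vert j i = d.vert j' i' ∨
      d.vert j (cycSucc (d.size j) i) = d.vert j' (cycSucc (d.size j') i')) : j = j' ∧ i = i' := by
  rcases he with he | he
  · exact d.vert_injective h.1 h.2.1 h'.1 h'.2.1 he
  · obtain ⟨rfl, h2⟩ := d.vert_injective h.1 (cycSucc_lt h.2.1) h'.1 (cycSucc_lt h'.2.1) he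
    refine ⟨rfl, ?_⟩
    rw [← cycPred_cycSucc h.2.1, h2, cycPred_cycSucc h'.2.1]

/-- Two edges are not the reverse of each other. -/
lemma not_reverse {j i j' i' : ℕ} (h : d.IsEdge j i) (h' : d.IsEdge j' i')
    (h1 : d.vert j i = d.vert j' (cycSucc (d.size j') i')) :
    d.vert j (cycSucc (d.size j) i) ≠ d.vert j' i' := by
  intro h2
  obtain ⟨rfl, h3⟩ := d.vert_injective h.1 h.2.1 h'.1 (cycSucc_lt h'.2.1) h1
  obtain ⟨-, h4⟩ := d.vert_injective h.1 (cycSucc_lt h.2.1) h'.1 h'.2.1 h2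
  have h5 := d.two_le_size j h.1
  have h6 := d.three_le_size j h.1
  obtain ⟨-, h7, h8⟩ := h
  obtain ⟨-, h7', h8'⟩ := h'
  unfold cycSucc at h3 h4
  split_ifs at h3 h4 <;> first | omega | grind

lemma edge_injOn : Set.InjOn d.edge d.edges := by
  rintro ⟨j, i⟩ h ⟨j', i'⟩ h' he
  rw [mem_coe, PathCycleShape.mem_edges] at h h'
  simp only [edge, Sym2.eq_iff] at he
  rcases he with he | he
  · obtain ⟨rfl, rfl⟩ := eq_of_vert_eq h h' (Or.inl he.1)
    rfl
  · exact absurd he.2 (not_reverse h h' he.1)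

lemma exists_edge_eq {e : Sym2 V} (he : e ∈ G.edgeSet) : ∃ p ∈ d.edges, d.edge p = e := by
  induction e with
  | _ u w =>
  obtain ⟨j, i, h, h'⟩ := (d.adj_iff u w).1 he
  refine ⟨⟨j, i⟩, PathCycleShape.mem_edges.2 h, ?_⟩
  rcases h' with ⟨rfl, rfl⟩ | ⟨rfl, rfl⟩
  · rfl
  · exact Sym2.eq_swap

lemma adj_succ {j i : ℕ} (h : d.IsEdge j i) :
    G.Adj (d.vert j i) (d.vert j (cycSucc (d.size j) i)) :=
  (d.adj_iff _ _).2 ⟨j, i, h, Or.inl ⟨rfl, rfl⟩⟩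

lemma card_edges_le [Fintype V] : d.edges.card ≤ Nat.card G.edgeSet := by
  rw [Nat.card_coe_set_eq, ← card_image_of_injOn d.edge_injOn, ← Set.ncard_coe_finset]
  refine Set.ncard_le_ncard ?_ (Set.toFinite _)
  intro e he
  obtain ⟨⟨j, i⟩, hp, rfl⟩ := mem_image.1 (mem_coe.1 he)
  exact adj_succ (PathCycleShape.mem_edges.1 hp)

lemma card_verts_le [Fintype V] : d.verts.card ≤ Fintype.card V := by
  rw [← card_univ]
  refine card_le_card_of_injOn (fun p => d.vert p.1 p.2) (fun _ _ => mem_univ _) ?_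
  rintro ⟨j, i⟩ h ⟨j', i'⟩ h' he
  rw [mem_coe, PathCycleShape.mem_verts] at h h'
  obtain ⟨rfl, rfl⟩ := d.vert_injective h.1 h.2 h'.1 h'.2 he
  rfl

variable (d)

/-- The orientation of `G` given by `PathCycleShape.IsForward`. -/
def Arc (u w : V) : Prop := ∃ j i, d.IsEdge j i ∧
  (d.IsForward j i ∧ u = d.vert j i ∧ w = d.vert j (cycSucc (d.size j) i) ∨
    ¬ d.IsForward j i ∧ w = d.vert j i ∧ u = d.vert j (cycSucc (d.size j) i))

noncomputable def edgeLabel (e : Sym2 V) : ℕ :=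
  let p := Function.invFunOn d.edge d.edges e
  d.label p.1 p.2

variable {d}

lemma edgeLabel_edge {j i : ℕ} (h : d.IsEdge j i) : d.edgeLabel (d.edge ⟨j, i⟩) = d.label j i := by
  unfold edgeLabel
  rw [d.edge_injOn.leftInvOn_invFunOn (mem_coe.2 (PathCycleShape.mem_edges.2 h))]

lemma isOrientation_arc : IsOrientation G d.Arc := by
  constructor
  · intro u w
    rw [d.adj_iff]
    constructor
    · rintro ⟨j, i, h, h'⟩
      by_cases hf : d.IsForward j i
      · rcases h' with h' | h'
        · exact Or.inl ⟨j, i, h, Or.inl ⟨hf, h'⟩⟩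
        · exact Or.inr ⟨j, i, h, Or.inl ⟨hf, h'⟩⟩
      · rcases h' with h' | h'
        · exact Or.inr ⟨j, i, h, Or.inr ⟨hf, h'⟩⟩
        · exact Or.inl ⟨j, i, h, Or.inr ⟨hf, h'⟩⟩
    · rintro (⟨j, i, h, ⟨-, h'⟩ | ⟨-, h'⟩⟩ | ⟨j, i, h, ⟨-, h'⟩ | ⟨-, h'⟩⟩)
      · exact ⟨j, i, h, Or.inl h'⟩
      · exact ⟨j, i, h, Or.inr h'⟩
      · exact ⟨j, i, h, Or.inr h'⟩
      · exact ⟨j, i, h, Or.inl h'⟩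
  · rintro u w ⟨⟨j, i, h, ⟨hf, rfl, rfl⟩ | ⟨hf, rfl, rfl⟩⟩,
      ⟨j', i', h', ⟨hf', h1, h2⟩ | ⟨hf', h1, h2⟩⟩⟩
    · exact not_reverse h h' h2 h1
    · obtain ⟨rfl, rfl⟩ := eq_of_vert_eq h h' (Or.inl h1)
      exact hf' hf
    · obtain ⟨rfl, rfl⟩ := eq_of_vert_eq h h' (Or.inl h1)
      exact hf hf'
    · exact not_reverse h h' h2 h1

lemma arc_succ {j i : ℕ} (h : d.IsEdge j i) :
    d.Arc (d.vert j i) (d.vert j (cycSucc (d.size j) i)) ↔ d.IsForward j i := by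
  constructor
  · rintro ⟨j', i', h', ⟨hf', h1, h2⟩ | ⟨hf', h1, h2⟩⟩
    · obtain ⟨rfl, rfl⟩ := eq_of_vert_eq h h' (Or.inl h1)
      exact hf'
    · exact absurd h1 (not_reverse h h' h2)
  · exact fun hf => ⟨j, i, h, Or.inl ⟨hf, rfl, rfl⟩⟩

lemma arc_succ_reverse {j i : ℕ} (h : d.IsEdge j i) :
    d.Arc (d.vert j (cycSucc (d.size j) i)) (d.vert j i) ↔ ¬ d.IsForward j i := by
  have h1 := (isOrientation_arc (d := d)).1 (d.vert j i) (d.vert j (cycSucc (d.size j) i))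
  have h2 := (isOrientation_arc (d := d)).2 (d.vert j i) (d.vert j (cycSucc (d.size j) i))
  have h3 := adj_succ h
  have h4 := arc_succ h
  tauto

lemma adj_vert_iff {j i : ℕ} (hj : j < d.num) (hi : i < d.size j) (w : V) :
    G.Adj (d.vert j i) w ↔ d.IsEdge j i ∧ w = d.vert j (cycSucc (d.size j) i) ∨
      d.IsEdge j (cycPred (d.size j) i) ∧ w = d.vert j (cycPred (d.size j) i) := by
  rw [d.adj_iff]
  constructor
  · rintro ⟨j', i', h, ⟨h1, rfl⟩ | ⟨rfl, h1⟩⟩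
    · obtain ⟨rfl, rfl⟩ := d.vert_injective hj hi h.1 h.2.1 h1
      exact Or.inl ⟨h, rfl⟩
    · obtain ⟨rfl, rfl⟩ := d.vert_injective hj hi h.1 (cycSucc_lt h.2.1) h1
      rw [cycPred_cycSucc h.2.1]
      exact Or.inr ⟨h, rfl⟩
  · rintro (⟨h, rfl⟩ | ⟨h, rfl⟩)
    · exact ⟨j, i, h, Or.inl ⟨rfl, rfl⟩⟩
    · exact ⟨j, _, h, Or.inr ⟨rfl, by rw [cycSucc_cycPred hi]⟩⟩

lemma orientedSum_vert [Fintype V] {j i : ℕ} (hj : j < d.num) (hi : i < d.size j) :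
    orientedSum G d.Arc d.edgeLabel (d.vert j i) = d.vsum j i := by
  set a := cycPred (d.size j) i with ha
  have hai : cycSucc (d.size j) a = i := cycSucc_cycPred hi
  have hN : (G.neighborSet (d.vert j i)).toFinite.toFinset =
      (if d.IsEdge j i then {d.vert j (cycSucc (d.size j) i)} else ∅) ∪
        if d.IsEdge j a then {d.vert j a} else ∅ := by
    ext w
    rw [Set.Finite.mem_toFinset, SimpleGraph.mem_neighborSet, adj_vert_iff hj hi, mem_union, ← ha]
    split_ifs with h1 h2 h2 <;> simp [h1, h2]
  have hdisj : Disjoint (if d.IsEdge j i then {d.vert j (cycSucc (d.size j) i)} else ∅ : Finset V)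
      (if d.IsEdge j a then {d.vert j a} else ∅) := by
    split_ifs with h1 h2
    · rw [disjoint_singleton]
      exact not_reverse h1 h2 (by rw [hai])
    all_goals simp
  unfold orientedSum
  rw [hN, sum_union hdisj, PathCycleShape.vsum, ← ha]
  congr 1
  · by_cases h : d.IsEdge j i
    · have h1 : d.edgeLabel s(d.vert j i, d.vert j (cycSucc (d.size j) i)) = d.label j i :=
        edgeLabel_edge h
      rw [if_pos h, sum_singleton, h1, arc_succ_reverse h]
      split_ifs <;> rfl
    · simp [h, PathCycleShape.label_eq_zero hj hi h]
  · by_cases h : d.IsEdge j a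
    · have h1 : d.edgeLabel s(d.vert j i, d.vert j a) = d.label j a := by
        rw [← edgeLabel_edge h, edge, hai, Sym2.eq_swap]
      have h2 := arc_succ h
      rw [hai] at h2
      rw [if_pos h, sum_singleton, h1, h2]
    · have h1 : d.label j a = 0 := PathCycleShape.label_eq_zero hj (cycPred_lt hi) h
      simp [h, h1]

lemma exists_vert_eq {u w : V} (h : G.Adj u w) :
    ∃ j i, j < d.num ∧ i < d.size j ∧ u = d.vert j i := by
  obtain ⟨j, i, he, ⟨rfl, -⟩ | ⟨-, rfl⟩⟩ := (d.adj_iff u w).1 h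
  · exact ⟨j, i, he.1, he.2.1, rfl⟩
  · exact ⟨j, _, he.1, cycSucc_lt he.2.1, rfl⟩

theorem hasQuasiOrientedAntimagicOrientation [Fintype V] (d : PathCycleDecomposition G) :
    HasQuasiOrientedAntimagicOrientation G ((2 * Fintype.card V) / 3) := by
  refine ⟨d.Arc, isOrientation_arc, d.edgeLabel, ?_, ?_, ?_⟩
  · intro e he
    obtain ⟨⟨j, i⟩, hp, rfl⟩ := d.exists_edge_eq he
    rw [PathCycleShape.mem_edges] at hp
    have h1 := d.label_pos hp
    have h2 := d.label_le (j := j) (i := i)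
    have h3 := d.three_mul_card_special_le
    have h4 := d.card_verts_le
    have h5 := d.card_edges_le
    rw [edgeLabel_edge hp, mem_Icc]
    omega
  · intro e he e' he' hne heq
    obtain ⟨⟨j, i⟩, hp, rfl⟩ := d.exists_edge_eq he
    obtain ⟨⟨j', i'⟩, hp', rfl⟩ := d.exists_edge_eq he'
    rw [PathCycleShape.mem_edges] at hp hp'
    rw [edgeLabel_edge hp, edgeLabel_edge hp'] at heq
    obtain ⟨rfl, rfl⟩ := d.label_injective hp hp' heq
    exact hne rfl
  · intro u w hne hu hw heq
    have key : ∀ v, 1 ≤ Nat.card (G.neighborSet v) →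
        ∃ j i, j < d.num ∧ i < d.size j ∧ v = d.vert j i := by
      intro v hv
      obtain ⟨⟨x, hx⟩⟩ := (Nat.card_pos_iff.1 hv).1
      exact exists_vert_eq hx
    obtain ⟨j, i, hj, hi, rfl⟩ := key u hu
    obtain ⟨j', i', hj', hi', rfl⟩ := key w hw
    rw [orientedSum_vert hj hi, orientedSum_vert hj' hi'] at heq
    obtain ⟨rfl, rfl⟩ := d.vsum_injective hj hi hj' hi' heq
    exact hne rfl

end PathCycleDecomposition

end PathCycle

/-- If `G` is a graph on `n` vertices with maximum degree at most `2`, then `G` admits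
an orientation that is `⌊2n/3⌋`-quasi-oriented-antimagic. -/
theorem statement_6 {V : Type*} [Fintype V] (G : SimpleGraph V)
    (hmax : ∀ v : V, Nat.card (G.neighborSet v) ≤ 2) :
    HasQuasiOrientedAntimagicOrientation G ((2 * Fintype.card V) / 3) := by
  rcases isEmpty_or_nonempty V with hV | hV
  · exact ⟨fun _ _ => False, ⟨fun u => isEmptyElim u, fun u => isEmptyElim u⟩, fun _ => 0,
      fun e => e.inductionOn fun u => isEmptyElim u, fun e => e.inductionOn fun u => isEmptyElim u,
      fun u => isEmptyElim u⟩
  · have hdeg : ∀ v a b w, G.Adj v a → G.Adj v b → G.Adj v w → a ≠ b → w = a ∨ w = b := by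
      intro v a b w ha hb hw hab
      by_contra! hne
      have h1 : ({a, b, w} : Set V).ncard = 3 := Set.ncard_eq_three.2
        ⟨a, b, w, hab, hne.1.symm, hne.2.symm, rfl⟩
      have h2 : ({a, b, w} : Set V) ⊆ G.neighborSet v := by
        rintro x (rfl | rfl | rfl) <;> assumption
      have h3 := Set.ncard_le_ncard h2 (Set.toFinite _)
      have h4 := hmax v
      rw [Nat.card_coe_set_eq] at h4
      omega
    obtain ⟨d⟩ := PathCycleDecomposition.nonempty_of_degree_le_two G hdeg
    exact d.hasQuasiOrientedAntimagicOrientation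
end

section
/- For all integers N ≥ 1 and s ≥ 0, the coefficient of the monomial ∏_{1 ≤ i ≤ N} x_i^{s(N−1)+i−1} in the polynomial ∏_{1 ≤ i < j ≤ N} (x_i − x_j)^{2s+1} has absolute value ((s+1)N)! / (N! · ((s+1)!)^N); in particular, this coefficient is nonzero. -/
open MvPolynomial

/-- The product of the differences `X j - X i` over `j ∈ S`, `j ≠ i`. -/
noncomputable def dysonFactor {σ : Type*} [DecidableEq σ] (R : Type*) [CommRing R]
    (S : Finset σ) (i : σ) : MvPolynomial σ R :=
  ∏ j ∈ S.erase i, (X j - X i)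

/-- The Dyson product `∏_{i ≠ j} (X j - X i) ^ a i`, over `i, j ∈ S`. -/
noncomputable def dysonProd {σ : Type*} [DecidableEq σ] (R : Type*) [CommRing R]
    (S : Finset σ) (a : σ → ℕ) : MvPolynomial σ R :=
  ∏ i ∈ S, dysonFactor R S i ^ a i

/-- The exponent of the monomial `∏_{i ≠ j} X j ^ a i`, over `i, j ∈ S`. -/
noncomputable def dysonExp {σ : Type*} [DecidableEq σ] (S : Finset σ) (a : σ → ℕ) : σ →₀ ℕ :=
  ∑ i ∈ S, a i • ∑ j ∈ S.erase i, Finsupp.single j 1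

lemma degreeOf_mul_X_sub_X {σ R : Type*} [CommRing R] [Nontrivial R] {k i : σ} {m : ℕ}
    {p : MvPolynomial σ R} (hp : p.degreeOf k ≤ m) (hi : i ≠ k) : (p * (X k - X i)).degreeOf k ≤ m + 1 := by
  refine (degreeOf_mul_le _ _ _).trans (add_le_add hp ((degreeOf_sub_le _ _ _).trans ?_))
  rw [degreeOf_X_self, degreeOf_X_of_ne hi.symm]
  simp

lemma prod_X_eq_monomial {σ R : Type*} [CommRing R] (S : Finset σ) :
    ∏ i ∈ S, (X i : MvPolynomial σ R) = monomial (∑ i ∈ S, Finsupp.single i 1) 1 := by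
  rw [monomial_sum_one]
  rfl

section Dyson

variable {σ R : Type*} [DecidableEq σ] [CommRing R]

lemma coeff_mul_X_sub_X {k i : σ} {m : ℕ} {p : MvPolynomial σ R} (hp : p.degreeOf k ≤ m)
    (hi : i ≠ k) (d : σ →₀ ℕ) :
    coeff (d + Finsupp.single k (m + 1)) (p * (X k - X i)) = coeff (d + Finsupp.single k m) p := by
  rw [mul_sub, coeff_sub, Finsupp.single_add, ← add_assoc, coeff_mul_X, coeff_mul_X']
  split_ifs with h
  · rw [sub_eq_self]
    by_contra hc
    have h1 := monomial_le_degreeOf k (mem_support_iff.2 hc)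
    simp [hi] at h1
    omega
  · simp

lemma coeff_mul_X_sub_X_pow [Nontrivial R] {k i : σ} {m : ℕ}
    {p : MvPolynomial σ R} (hp : p.degreeOf k ≤ m) (hi : i ≠ k) (n : ℕ) :
    (p * (X k - X i) ^ n).degreeOf k ≤ m + n ∧ ∀ d : σ →₀ ℕ,
      coeff (d + Finsupp.single k (m + n)) (p * (X k - X i) ^ n) =
        coeff (d + Finsupp.single k m) p := by
  induction n with
  | zero => simpa using hp
  | succ n ih =>
    rw [pow_succ, ← mul_assoc, ← add_assoc]
    exact ⟨degreeOf_mul_X_sub_X ih.1 hi, fun d => (coeff_mul_X_sub_X ih.1 hi d).trans (ih.2 d)⟩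

lemma coeff_mul_prod_X_sub_X_pow [Nontrivial R] {k : σ} {p : MvPolynomial σ R}
    (hp : p.degreeOf k = 0) (a : σ → ℕ) (T : Finset σ) (hT : k ∉ T) :
    (p * ∏ i ∈ T, (X k - X i) ^ a i).degreeOf k ≤ ∑ i ∈ T, a i ∧ ∀ d : σ →₀ ℕ,
      coeff (d + Finsupp.single k (∑ i ∈ T, a i)) (p * ∏ i ∈ T, (X k - X i) ^ a i) =
        coeff d p := by
  induction T using Finset.induction_on with
  | empty => simp [hp]
  | insert i T hi ih =>
    rw [Finset.mem_insert, not_or] at hT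
    obtain ⟨h1, h2⟩ := ih hT.2
    obtain ⟨h3, h4⟩ := coeff_mul_X_sub_X_pow h1 (Ne.symm hT.1) (a i)
    rw [Finset.prod_insert hi, Finset.sum_insert hi, mul_comm ((X k - X i) ^ a i), ← mul_assoc,
      add_comm (a i)]
    exact ⟨h3, fun d => (h4 d).trans (h2 d)⟩

lemma degreeOf_dysonProd_of_notMem [Nontrivial R] {k : σ} {S : Finset σ} (hk : k ∉ S) (a : σ → ℕ) :
    (dysonProd R S a).degreeOf k = 0 := by
  refine Nat.le_zero.1 ((degreeOf_prod_le _ _ _).trans (Finset.sum_nonpos fun i hi => ?_))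
  refine (degreeOf_pow_le _ _ _).trans (Nat.le_zero.2 (mul_eq_zero_of_right _ ?_))
  refine Nat.le_zero.1 ((degreeOf_prod_le _ _ _).trans (Finset.sum_nonpos fun j hj => ?_))
  refine (degreeOf_sub_le _ _ _).trans ?_
  rw [degreeOf_X_of_ne, degreeOf_X_of_ne]
  · simp
  · rintro rfl; exact hk hi
  · rintro rfl; exact hk (Finset.mem_of_mem_erase hj)

lemma coeff_dysonProd_erase [Nontrivial R] {k : σ} {S : Finset σ} (hk : k ∈ S) {a : σ → ℕ} (ha : a k = 0) :
    coeff (dysonExp S a) (dysonProd R S a) =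
      coeff (dysonExp (S.erase k) a) (dysonProd R (S.erase k) a) := by
  have key : ∀ i ∈ S.erase k, k ∈ S.erase i := fun i hi =>
    Finset.mem_erase.2 ⟨(Finset.ne_of_mem_erase hi).symm, hk⟩
  have h1 : dysonProd R S a =
      dysonProd R (S.erase k) a * ∏ i ∈ S.erase k, (X k - X i) ^ a i := by
    rw [dysonProd, ← Finset.mul_prod_erase S _ hk, ha, pow_zero, one_mul, dysonProd,
      ← Finset.prod_mul_distrib]
    refine Finset.prod_congr rfl fun i hi => ?_
    rw [dysonFactor, ← Finset.mul_prod_erase _ _ (key i hi), Finset.erase_right_comm, mul_pow,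
      mul_comm, dysonFactor]
  have h2 : dysonExp S a =
      dysonExp (S.erase k) a + Finsupp.single k (∑ i ∈ S.erase k, a i) := by
    rw [dysonExp, ← Finset.add_sum_erase S _ hk, ha, zero_smul, zero_add, dysonExp,
      Finsupp.single_finsetSum, ← Finset.sum_add_distrib]
    refine Finset.sum_congr rfl fun i hi => ?_
    rw [← Finset.add_sum_erase _ _ (key i hi), Finset.erase_right_comm, smul_add, add_comm,
      Finsupp.smul_single, smul_eq_mul, mul_one]
  rw [h1, h2]
  exact (coeff_mul_prod_X_sub_X_pow (degreeOf_dysonProd_of_notMem (Finset.notMem_erase k S) a) a _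
    (Finset.notMem_erase k S)).2 _

lemma dysonProd_update {S : Finset σ} {j : σ} (hj : j ∈ S) {a : σ → ℕ} (ha : 0 < a j) :
    dysonProd R S (Function.update a j (a j - 1)) * dysonFactor R S j = dysonProd R S a := by
  rw [dysonProd, dysonProd, ← Finset.mul_prod_erase S _ hj, ← Finset.mul_prod_erase S _ hj,
    Function.update_self, mul_right_comm, ← pow_succ, Nat.sub_add_cancel ha]
  congr 1
  exact Finset.prod_congr rfl fun i hi => by
    rw [Function.update_of_ne (Finset.ne_of_mem_erase hi)]

lemma dysonExp_update {S : Finset σ} {j : σ} (hj : j ∈ S) {a : σ → ℕ} (ha : 0 < a j) :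
    dysonExp S (Function.update a j (a j - 1)) + ∑ i ∈ S.erase j, Finsupp.single i 1 =
      dysonExp S a := by
  rw [dysonExp, dysonExp, ← Finset.add_sum_erase S _ hj, ← Finset.add_sum_erase S _ hj,
    Function.update_self, add_right_comm, ← succ_nsmul, Nat.sub_add_cancel ha]
  congr 1
  exact Finset.sum_congr rfl fun i hi => by
    rw [Function.update_of_ne (Finset.ne_of_mem_erase hi)]

lemma sum_prod_erase_div {K : Type*} [Field K] {S : Finset σ} (hS : S.Nonempty) {v : σ → K}
    (hv : Set.InjOn v S) : ∑ j ∈ S, (∏ i ∈ S.erase j, v i) / ∏ i ∈ S.erase j, (v i - v j) = 1 := by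
  have h := congrArg (Polynomial.eval 0) (Lagrange.sum_basis hv hS)
  rw [Polynomial.eval_finsetSum, Polynomial.eval_one] at h
  rw [← h]
  refine Finset.sum_congr rfl fun j hj => ?_
  rw [Lagrange.basis, Polynomial.eval_prod, ← Finset.prod_div_distrib]
  refine Finset.prod_congr rfl fun i hi => ?_
  rw [Lagrange.basisDivisor, Polynomial.eval_mul, Polynomial.eval_C, Polynomial.eval_sub,
    Polynomial.eval_X, Polynomial.eval_C, zero_sub, ← neg_sub (v i), inv_neg, neg_mul_neg,
    div_eq_inv_mul]

lemma dysonProd_eq_sum [IsDomain R] {S : Finset σ} (hS : S.Nonempty) {a : σ → ℕ}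
    (ha : ∀ j ∈ S, 0 < a j) :
    dysonProd R S a =
      ∑ j ∈ S, dysonProd R S (Function.update a j (a j - 1)) * ∏ i ∈ S.erase j, X i := by
  let f := algebraMap (MvPolynomial σ R) (FractionRing (MvPolynomial σ R))
  have hf : Function.Injective f := IsFractionRing.injective _ _
  have hv : Function.Injective fun i : σ => f (X i) := hf.comp (X_injective (R := R))
  apply hf
  have h := sum_prod_erase_div hS (v := fun i => f (X i)) hv.injOn
  rw [← mul_one (f (dysonProd R S a)), ← h, Finset.mul_sum, map_sum]
  refine Finset.sum_congr rfl fun j hj => ?_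
  have hne : ∏ i ∈ S.erase j, (f (X i) - f (X j)) ≠ 0 :=
    Finset.prod_ne_zero_iff.2 fun i hi => sub_ne_zero.2 (hv.ne (Finset.ne_of_mem_erase hi))
  rw [← dysonProd_update hj (ha j hj), map_mul, map_mul, dysonFactor, map_prod, map_prod]
  simp only [map_sub]
  field_simp

/-- The Dyson constant term identity, stated for an arbitrary finite set of variables. -/
theorem coeff_dysonProd_mul_prod_factorial [IsDomain R] (S : Finset σ) (a : σ → ℕ) :
    coeff (dysonExp S a) (dysonProd R S a) * ∏ i ∈ S, ((a i).factorial : R) =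
      ((∑ i ∈ S, a i).factorial : R) := by
  induction hn : S.card + ∑ i ∈ S, a i using Nat.strong_induction_on generalizing S a with
  | h n ih =>
  subst hn
  rcases S.eq_empty_or_nonempty with rfl | hS
  · simp [dysonExp, dysonProd]
  by_cases h0 : ∃ k ∈ S, a k = 0
  · obtain ⟨k, hk, ha⟩ := h0
    have hsum := Finset.add_sum_erase S a hk
    have hcard := Finset.card_erase_lt_of_mem hk
    rw [ha, zero_add] at hsum
    rw [coeff_dysonProd_erase hk ha, ← Finset.mul_prod_erase S _ hk, ha, Nat.factorial_zero,
      Nat.cast_one, one_mul, ← hsum]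
    exact ih _ (by omega) _ _ rfl
  · push Not at h0
    have ha : ∀ j ∈ S, 0 < a j := fun j hj => Nat.pos_of_ne_zero (h0 j hj)
    have hpos : 0 < ∑ i ∈ S, a i := Finset.sum_pos ha hS
    obtain ⟨m, hm⟩ := Nat.exists_eq_succ_of_ne_zero hpos.ne'
    have hstep : ∀ j ∈ S, coeff (dysonExp S a)
        (dysonProd R S (Function.update a j (a j - 1)) * ∏ i ∈ S.erase j, X i) *
          ∏ i ∈ S, ((a i).factorial : R) = a j * (m.factorial : R) := by
      intro j hj
      have hsum : ∑ i ∈ S, Function.update a j (a j - 1) i = m := by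
        have h1 := Finset.add_sum_erase S a hj
        have h2 := ha j hj
        rw [Finset.sum_update_of_mem hj, ← Finset.erase_eq]
        omega
      have h := ih _ (by rw [hsum]; omega) S (Function.update a j (a j - 1)) rfl
      rw [hsum] at h
      rw [← h, prod_X_eq_monomial, ← dysonExp_update hj (ha j hj), coeff_mul_monomial, mul_one,
        mul_left_comm, ← Finset.mul_prod_erase S _ hj, ← Finset.mul_prod_erase S _ hj,
        ← mul_assoc (a j : R), Function.update_self]
      congr 2
      · rw [← Nat.mul_factorial_pred (ha j hj).ne', Nat.cast_mul]
      · exact Finset.prod_congr rfl fun i hi => by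
          rw [Function.update_of_ne (Finset.ne_of_mem_erase hi)]
    rw [dysonProd_eq_sum hS ha, coeff_sum, Finset.sum_mul, Finset.sum_congr rfl hstep,
      ← Finset.sum_mul, ← Nat.cast_sum, hm, Nat.factorial_succ, Nat.cast_mul]

end Dyson

section Vandermonde

variable {n : ℕ} {R : Type*} [CommRing R]

lemma rename_det_vandermonde_X (τ : Equiv.Perm (Fin n)) :
    rename τ (Matrix.vandermonde (X : Fin n → MvPolynomial (Fin n) R)).det =
      (τ.sign : MvPolynomial (Fin n) R) * (Matrix.vandermonde X).det := by
  rw [← Matrix.det_permute, AlgHom.map_det]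
  congr 1
  ext1 i j
  simp [Matrix.vandermonde]

lemma intCast_sign_pow_odd {S : Type*} [CommRing S] (τ : Equiv.Perm (Fin n)) (s : ℕ) :
    (τ.sign : S) ^ (2 * s + 1) = τ.sign := by
  rcases Int.units_eq_one_or τ.sign with h | h <;> simp [h, (odd_two_mul_add_one s).neg_pow]

lemma coeff_mapDomain_vandermonde_pow (τ : Equiv.Perm (Fin n)) (s : ℕ) (d : Fin n →₀ ℕ) :
    coeff (d.mapDomain τ) ((Matrix.vandermonde (X : Fin n → MvPolynomial (Fin n) R)).det
      ^ (2 * s + 1)) =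
      τ.sign * coeff d ((Matrix.vandermonde X).det ^ (2 * s + 1)) := by
  have hrename := coeff_rename_mapDomain τ τ.injective
    ((Matrix.vandermonde (X : Fin n → MvPolynomial (Fin n) R)).det ^ (2 * s + 1)) d
  rw [map_pow, rename_det_vandermonde_X, mul_pow, intCast_sign_pow_odd] at hrename
  rw [← hrename]
  rcases Int.units_eq_one_or τ.sign with h | h <;> simp [h]

/-- Extracting the coefficient of a power of `∏ X i` from an even power of the Vandermonde
determinant by expanding one factor. -/
lemma coeff_vandermonde_pow_even (s : ℕ) :
    coeff (Finsupp.equivFunOnFinite.symm fun _ : Fin n => (s + 1) * (n - 1))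
      ((Matrix.vandermonde (X : Fin n → MvPolynomial (Fin n) R)).det ^ (2 * (s + 1))) =
      (Fin.revPerm (n := n)).sign * (n.factorial * coeff
        (Finsupp.equivFunOnFinite.symm fun i : Fin n => s * (n - 1) + i.1)
        ((Matrix.vandermonde (X : Fin n → MvPolynomial (Fin n) R)).det ^ (2 * s + 1))) := by
  set Q := (Matrix.vandermonde (X : Fin n → MvPolynomial (Fin n) R)).det ^ (2 * s + 1) with hQ
  set e : Fin n →₀ ℕ := Finsupp.equivFunOnFinite.symm fun i : Fin n => s * (n - 1) + i.1
  have hterm : ∀ τ : Equiv.Perm (Fin n),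
      coeff (Finsupp.equivFunOnFinite.symm fun _ : Fin n => (s + 1) * (n - 1))
        (((τ.sign • ∏ i, Matrix.vandermonde X (τ i) i : MvPolynomial (Fin n) R)) * Q) =
      (Fin.revPerm (n := n)).sign * coeff e Q := by
    intro τ
    let m : Fin n →₀ ℕ := ∑ i, Finsupp.single (τ i) i.1
    have hm : ∏ i, Matrix.vandermonde (X : Fin n → MvPolynomial (Fin n) R) (τ i) i =
        monomial m 1 := by
      rw [monomial_sum_one]
      exact Finset.prod_congr rfl fun i _ => X_pow_eq_monomial
    have hexp : (Finsupp.equivFunOnFinite.symm fun _ : Fin n => (s + 1) * (n - 1)) =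
        m + e.mapDomain (τ * Fin.revPerm : Equiv.Perm (Fin n)) := by
      ext k
      obtain ⟨i, rfl⟩ := τ.surjective k
      have h1 : e.mapDomain (τ * Fin.revPerm : Equiv.Perm (Fin n)) (τ i) = e (Fin.rev i) := by
        rw [← Finsupp.mapDomain_apply (τ * Fin.revPerm : Equiv.Perm (Fin n)).injective e]
        simp
      have h2 : m (τ i) = i.1 := by
        simp [m, Finsupp.finsetSum_apply, Finsupp.single_apply]
      rw [Finsupp.add_apply, h1, h2]
      have := i.2
      simp only [e, Finsupp.coe_equivFunOnFinite_symm, Fin.val_rev, add_mul]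
      omega
    rw [hm, smul_mul_assoc, hexp, Units.smul_def, coeff_smul, coeff_monomial_mul, one_mul, hQ,
      coeff_mapDomain_vandermonde_pow, map_mul]
    rcases Int.units_eq_one_or τ.sign with h | h <;> simp [h]
  rw [show 2 * (s + 1) = 2 * s + 1 + 1 by ring, pow_succ', ← hQ, Matrix.det_apply,
    Finset.sum_mul, coeff_sum, Finset.sum_congr rfl fun τ _ => hterm τ, Finset.sum_const,
    Finset.card_univ, Fintype.card_perm, Fintype.card_fin, nsmul_eq_mul, mul_left_comm]

lemma prod_eq_or_eq_neg {ι S : Type*} [CommRing S] (T : Finset ι) {f g : ι → S}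
    (h : ∀ i ∈ T, f i = g i ∨ f i = -g i) : ∏ i ∈ T, f i = ∏ i ∈ T, g i ∨
      ∏ i ∈ T, f i = -∏ i ∈ T, g i := by
  classical
  induction T using Finset.induction_on with
  | empty => simp
  | insert i T hi ih =>
    rw [Finset.prod_insert hi, Finset.prod_insert hi]
    rcases h i (Finset.mem_insert_self i T) with h1 | h1 <;>
    rcases ih fun j hj => h j (Finset.mem_insert_of_mem hj) with h2 | h2 <;> simp [h1, h2]

lemma prod_X_sub_X_eq_or_eq_neg :
    (∏ i : Fin n, ∏ j ∈ Finset.Ioi i, (X i - X j) : MvPolynomial (Fin n) R) =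
        (Matrix.vandermonde X).det ∨
      (∏ i : Fin n, ∏ j ∈ Finset.Ioi i, (X i - X j) : MvPolynomial (Fin n) R) =
        -(Matrix.vandermonde X).det := by
  rw [Matrix.det_vandermonde]
  exact prod_eq_or_eq_neg _ fun i _ => prod_eq_or_eq_neg _ fun j _ => Or.inr (neg_sub _ _).symm

lemma prod_dysonFactor_eq_or_eq_neg :
    ∏ i, dysonFactor R (Finset.univ : Finset (Fin n)) i = (Matrix.vandermonde X).det ^ 2 ∨
      ∏ i, dysonFactor R (Finset.univ : Finset (Fin n)) i = -(Matrix.vandermonde X).det ^ 2 := by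
  have h := Finset.prod_prod_Ioi_mul_eq_prod_prod_off_diag
    fun i j : Fin n => (X i - X j : MvPolynomial (Fin n) R)
  simp only [dysonFactor, ← Finset.compl_singleton]
  rw [← h, Matrix.det_vandermonde, ← Finset.prod_pow]
  simp only [← Finset.prod_pow]
  exact prod_eq_or_eq_neg _ fun i _ => prod_eq_or_eq_neg _ fun j _ => Or.inr (by ring)

end Vandermonde

/-- For integers `N ≥ 1` and `s ≥ 0`, the coefficient of the monomial
`∏_{1 ≤ i ≤ N} x_i^{s(N-1)+i-1}` in `∏_{1 ≤ i < j ≤ N} (x_i - x_j)^{2s+1}` has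
absolute value `((s+1)N)! / (N! ((s+1)!)^N)`; in particular it is nonzero.
(Here the variable `i : Fin N` corresponds to the index `i + 1 ∈ {1, …, N}`.) -/
theorem statement_8 (N s : ℕ) (hN : 1 ≤ N) :
    |MvPolynomial.coeff
        (Finsupp.equivFunOnFinite.symm fun i : Fin N => s * (N - 1) + i.1)
        (∏ i : Fin N, ∏ j ∈ Finset.Ioi i, (X i - X j) ^ (2 * s + 1) :
          MvPolynomial (Fin N) ℝ)| =
      (((s + 1) * N).factorial : ℝ) /
        ((N.factorial : ℝ) * ((s + 1).factorial : ℝ) ^ N) ∧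
    MvPolynomial.coeff
        (Finsupp.equivFunOnFinite.symm fun i : Fin N => s * (N - 1) + i.1)
        (∏ i : Fin N, ∏ j ∈ Finset.Ioi i, (X i - X j) ^ (2 * s + 1) :
          MvPolynomial (Fin N) ℝ) ≠ 0 := by
  set V := (Matrix.vandermonde (X : Fin N → MvPolynomial (Fin N) ℝ)).det with hV
  set e : Fin N →₀ ℕ := Finsupp.equivFunOnFinite.symm fun i : Fin N => s * (N - 1) + i.1
  have hP : |coeff e (∏ i : Fin N, ∏ j ∈ Finset.Ioi i, (X i - X j) ^ (2 * s + 1) :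
      MvPolynomial (Fin N) ℝ)| = |coeff e (V ^ (2 * s + 1))| := by
    simp only [Finset.prod_pow]
    rcases prod_X_sub_X_eq_or_eq_neg (n := N) (R := ℝ) with h | h
    · rw [h]
    · rw [h, (odd_two_mul_add_one s).neg_pow, coeff_neg, abs_neg]
  have hexp : dysonExp (Finset.univ : Finset (Fin N)) (fun _ => s + 1) =
      Finsupp.equivFunOnFinite.symm fun _ => (s + 1) * (N - 1) := by
    ext k
    simp [dysonExp, Finsupp.finsetSum_apply, Finsupp.single_apply, Finset.sum_ite,
      Finset.filter_ne, mul_comm]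
  have hD : |coeff (Finsupp.equivFunOnFinite.symm fun _ => (s + 1) * (N - 1))
      (dysonProd ℝ (Finset.univ : Finset (Fin N)) fun _ => s + 1)| =
        N.factorial * |coeff e (V ^ (2 * s + 1))| := by
    have habs : ∀ d, |coeff d (dysonProd ℝ (Finset.univ : Finset (Fin N)) fun _ => s + 1)| =
        |coeff d (V ^ (2 * (s + 1)))| := by
      intro d
      rw [dysonProd, Finset.prod_pow, pow_mul]
      rcases prod_dysonFactor_eq_or_eq_neg (n := N) (R := ℝ) with h | h
      · rw [h]
      · rw [h, neg_pow]
        rcases neg_one_pow_eq_or (MvPolynomial (Fin N) ℝ) (s + 1) with h' | h' <;> simp [h', hV]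
    rw [habs, coeff_vandermonde_pow_even, abs_mul, abs_mul, Nat.abs_cast]
    rcases Int.units_eq_one_or (Fin.revPerm (n := N)).sign with h | h <;> simp [h, hV, e]
  have hdyson := congrArg abs (coeff_dysonProd_mul_prod_factorial (R := ℝ)
    (Finset.univ : Finset (Fin N)) fun _ => s + 1)
  rw [hexp, abs_mul, hD, Finset.prod_const, Finset.sum_const, Finset.card_univ, Fintype.card_fin,
    smul_eq_mul, mul_comm N, Nat.abs_cast,
    abs_of_nonneg (by positivity : (0 : ℝ) ≤ ((s + 1).factorial : ℝ) ^ N)] at hdyson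
  have hmain : |coeff e (V ^ (2 * s + 1))| = (((s + 1) * N).factorial : ℝ) /
      ((N.factorial : ℝ) * ((s + 1).factorial : ℝ) ^ N) := by
    rw [← hdyson, eq_div_iff (by positivity)]
    ring
  rw [hP, hmain]
  refine ⟨rfl, abs_pos.1 ?_⟩
  rw [hP, hmain]
  positivity
end
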